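/- arXiv:2209.00283 — 3 statements merged into one kernel-verified Lean document; each statement's English description precedes it below -/
import Mathlib

section
/- The function φ_q is convex on K_q and the function φ_r is convex on K_r (both as extended-real-valued functions). -/
noncomputable section

open Finset

variable {X Y J : Type*}

/-- `f(u,v) = u·log u − u·log v` with the conventions `f(0,v) = 0` and `f(u,0) = +∞` for `u > 0`,
taking values in the extended reals. -/
def fdiv (u v : ℝ) : EReal :=
  if u = 0 then 0
  else if v = 0 then (⊤ : EReal)
  else ((u * Real.log u - u * Real.log v : ℝ) : EReal)

/-- Marginal `p_x := ∑_y p_{x,y}`. -/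
def margX [Fintype Y] (p : X → Y → ℝ) (x : X) : ℝ := ∑ y, p x y

/-- Marginal `p^y := ∑_x p_{x,y}`. -/
def margY [Fintype X] (p : X → Y → ℝ) (y : Y) : ℝ := ∑ x, p x y

/-- The polytope `K_q`: `q_{j|x} ≥ 0`, `∑_{j∋x} q_{j|x} = 1` for every `x`,
and `q_{j|x} = 0` whenever `x ∉ j`. -/
def Kq [Fintype J] [DecidableEq X] (S : J → Finset X) : Set (J → X → ℝ) :=
  {q | (∀ j x, 0 ≤ q j x) ∧ (∀ x, (∑ j, if x ∈ S j then q j x else 0) = 1) ∧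
    (∀ j x, x ∉ S j → q j x = 0)}

/-- The polytope `K_r`: `r_{j|y} ≥ 0` and `∑_j r_{j|y} = 1` for every `y`. -/
def Kr (J Y : Type*) [Fintype J] : Set (J → Y → ℝ) :=
  {r | (∀ j y, 0 ≤ r j y) ∧ ∀ y, (∑ j, r j y) = 1}

/-- `φ(q,r) := ∑_{x,y,j} p_{x,y} · f(q_{j|x}, r_{j|y})`, extended-real valued. -/
def phi [Fintype X] [Fintype Y] [Fintype J] (p : X → Y → ℝ)
    (q : J → X → ℝ) (r : J → Y → ℝ) : EReal :=
  ∑ x, ∑ y, ∑ j, (p x y : EReal) * fdiv (q j x) (r j y)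

/-- `δ(q,q') := ∑_x p_x ∑_{j∋x} f(q_{j|x}, q'_{j|x})`, extended-real valued. -/
def delta [Fintype X] [Fintype Y] [Fintype J] [DecidableEq X] (p : X → Y → ℝ)
    (S : J → Finset X) (q q' : J → X → ℝ) : EReal :=
  ∑ x, (margX p x : EReal) * ∑ j, (if x ∈ S j then fdiv (q j x) (q' j x) else 0)

/-- `R_{j|y}(q) := ∑_{x∈j} p_{x|y} q_{j|x}`. -/
def Rmap [Fintype X] [Fintype Y] [DecidableEq X] (p : X → Y → ℝ) (S : J → Finset X)
    (q : J → X → ℝ) : J → Y → ℝ :=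
  fun j y => ∑ x, if x ∈ S j then (p x y / margY p y) * q j x else 0

/-- `A_x(r) := ∑_{j∋x} ∏_y (r_{j|y})^{p^{y|x}}` (real powers, with `0^0 = 1`). -/
def Afun [Fintype Y] [Fintype J] [DecidableEq X] (p : X → Y → ℝ) (S : J → Finset X)
    (r : J → Y → ℝ) (x : X) : ℝ :=
  ∑ j, if x ∈ S j then (∏ y, r j y ^ (p x y / margX p x)) else 0

/-- `Q_{j|x}(r) := (∏_y (r_{j|y})^{p^{y|x}}) / A_x(r)` if `x ∈ j`, and `0` otherwise. -/
def Qmap [Fintype Y] [Fintype J] [DecidableEq X] (p : X → Y → ℝ) (S : J → Finset X)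
    (r : J → Y → ℝ) : J → X → ℝ :=
  fun j x => if x ∈ S j then (∏ y, r j y ^ (p x y / margX p x)) / Afun p S r x else 0

open Classical in
/-- `φ_r(r) := −∑_x p_x log A_x(r)`, equal to `+∞` if `A_x(r) = 0` for some `x`. -/
def phiR [Fintype X] [Fintype Y] [Fintype J] [DecidableEq X] (p : X → Y → ℝ)
    (S : J → Finset X) (r : J → Y → ℝ) : EReal :=
  if ∃ x, Afun p S r x = 0 then ⊤
  else (((- ∑ x, margX p x * Real.log (Afun p S r x)) : ℝ) : EReal)

/-- The explicit real-valued formula for `φ_q`: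
`∑_x p_x ∑_{j∋x} q_{j|x} log q_{j|x} − ∑_y p^y ∑_j R_{j|y}(q) log R_{j|y}(q)`
(with the convention `0·log 0 = 0`, automatic since `Real.log 0 = 0`). -/
def phiQexp [Fintype X] [Fintype Y] [Fintype J] [DecidableEq X] (p : X → Y → ℝ)
    (S : J → Finset X) (q : J → X → ℝ) : ℝ :=
  (∑ x, margX p x * ∑ j, if x ∈ S j then q j x * Real.log (q j x) else 0)
    - ∑ y, margY p y * ∑ j, Rmap p S q j y * Real.log (Rmap p S q j y)

/-- The convex corner `K_a := {a : 0 ≤ a_x ≤ A_x(r) (∀x) for some r ∈ K_r}`. -/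
def Ka [Fintype X] [Fintype Y] [Fintype J] [DecidableEq X] (p : X → Y → ℝ)
    (S : J → Finset X) : Set (X → ℝ) :=
  {a | ∃ r ∈ Kr J Y, ∀ x, 0 ≤ a x ∧ a x ≤ Afun p S r x}

open Classical in
/-- `φ_a(a) := −∑_x p_x log a_x`, equal to `+∞` if `a_x = 0` for some `x`. -/
def phiA [Fintype X] [Fintype Y] (p : X → Y → ℝ) (a : X → ℝ) : EReal :=
  if ∃ x, a x = 0 then ⊤
  else (((- ∑ x, margX p x * Real.log (a x)) : ℝ) : EReal)

/-- The inequality `log t ≤ t - 1` in homogeneous form. -/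
lemma mul_log_add_log_sub_log_le {u v t : ℝ} (hu : 0 ≤ u) (hv : 0 ≤ v) (huv : v = 0 → u = 0)
    (ht : 0 < t) : u * (Real.log t + Real.log v - Real.log u) ≤ t * v - u := by
  rcases hu.eq_or_lt with rfl | hu
  · simpa using mul_nonneg ht.le hv
  have hv' : 0 < v := hv.lt_of_ne fun h => hu.ne' (huv h.symm)
  rw [← Real.log_mul ht.ne' hv'.ne', ← Real.log_div (by positivity) hu.ne']
  calc u * Real.log (t * v / u) ≤ u * (t * v / u - 1) := by
        gcongr
        exact Real.log_le_sub_one_of_pos (by positivity)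
    _ = t * v - u := by field_simp

/-- The log-sum inequality for two pairs. -/
lemma add_mul_log_sub_le {u v u' v' : ℝ} (hu : 0 ≤ u) (hv : 0 ≤ v) (hu' : 0 ≤ u') (hv' : 0 ≤ v')
    (huv : v = 0 → u = 0) (huv' : v' = 0 → u' = 0) :
    (u + u') * Real.log (u + u') - (u + u') * Real.log (v + v') ≤
      (u * Real.log u - u * Real.log v) + (u' * Real.log u' - u' * Real.log v') := by
  rcases (add_nonneg hu hu').eq_or_lt with h | h
  · obtain rfl : u = 0 := by linarith
    obtain rfl : u' = 0 := by linarith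
    simp
  have hV : 0 < v + v' := by
    refine (add_nonneg hv hv').lt_of_ne fun h0 => h.ne' ?_
    rw [huv (by linarith), huv' (by linarith), add_zero]
  have ht : 0 < (u + u') / (v + v') := by positivity
  have h1 := mul_log_add_log_sub_log_le hu hv huv ht
  have h2 := mul_log_add_log_sub_log_le hu' hv' huv' ht
  have h3 : (u + u') / (v + v') * (v + v') = u + u' := by field_simp
  rw [Real.log_div h.ne' hV.ne'] at h1 h2
  linarith

lemma mul_mul_log_sub {a u v : ℝ} (huv : v = 0 → u = 0) :
    a * u * Real.log (a * u) - a * u * Real.log (a * v) =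
      a * (u * Real.log u - u * Real.log v) := by
  rcases eq_or_ne a 0 with rfl | ha
  · simp
  rcases eq_or_ne u 0 with rfl | hu
  · simp
  rw [Real.log_mul ha hu, Real.log_mul ha fun h => hu (huv h)]
  ring

/-- Joint convexity of `(u, v) ↦ u log u - u log v`. -/
lemma mul_log_sub_convex_comb_le {a b u v u' v' : ℝ} (ha : 0 ≤ a) (hb : 0 ≤ b)
    (hu : 0 ≤ u) (hv : 0 ≤ v) (hu' : 0 ≤ u') (hv' : 0 ≤ v')
    (huv : v = 0 → u = 0) (huv' : v' = 0 → u' = 0) :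
    (a * u + b * u') * Real.log (a * u + b * u')
        - (a * u + b * u') * Real.log (a * v + b * v') ≤
      a * (u * Real.log u - u * Real.log v) + b * (u' * Real.log u' - u' * Real.log v') := by
  rw [← mul_mul_log_sub huv, ← mul_mul_log_sub huv']
  apply add_mul_log_sub_le (by positivity) (by positivity) (by positivity) (by positivity)
  · exact fun h => (mul_eq_zero.1 h).elim (by simp +contextual) (by simp +contextual [huv])
  · exact fun h => (mul_eq_zero.1 h).elim (by simp +contextual) (by simp +contextual [huv'])

/-- Concavity of the weighted geometric mean on the nonnegative orthant. -/
lemma prod_rpow_concave {ι : Type*} [Fintype ι] {w r r' : ι → ℝ} {a b : ℝ}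
    (hw : ∀ i, 0 ≤ w i) (hw1 : ∑ i, w i = 1) (hr : ∀ i, 0 ≤ r i) (hr' : ∀ i, 0 ≤ r' i)
    (ha : 0 ≤ a) (hb : 0 ≤ b) :
    a * ∏ i, r i ^ w i + b * ∏ i, r' i ^ w i ≤ ∏ i, (a * r i + b * r' i) ^ w i := by
  have hm : ∀ i, 0 ≤ a * r i + b * r' i := fun i =>
    add_nonneg (mul_nonneg ha (hr i)) (mul_nonneg hb (hr' i))
  by_cases h0 : ∃ i, w i ≠ 0 ∧ a * r i + b * r' i = 0
  · obtain ⟨i, hwi, hi⟩ := h0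
    have key : ∀ {c : ℝ} {s : ι → ℝ}, c * s i = 0 → c * ∏ j, s j ^ w j = 0 := by
      intro c s h
      rcases mul_eq_zero.1 h with h | h
      · simp [h]
      · rw [Finset.prod_eq_zero (Finset.mem_univ i) (by rw [h, Real.zero_rpow hwi]), mul_zero]
    have h1 := mul_nonneg ha (hr i)
    have h2 := mul_nonneg hb (hr' i)
    rw [key (by linarith : a * r i = 0), key (by linarith : b * r' i = 0), add_zero]
    exact Finset.prod_nonneg fun j _ => Real.rpow_nonneg (hm j) _
  push Not at h0
  have key : ∀ s : ι → ℝ, (∀ i, 0 ≤ s i) →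
      ∏ i, s i ^ w i ≤
        (∏ i, (a * r i + b * r' i) ^ w i) * ∑ i, w i * (s i / (a * r i + b * r' i)) := by
    intro s hs
    have h1 : ∏ i, s i ^ w i = (∏ i, (a * r i + b * r' i) ^ w i) *
        ∏ i, (s i / (a * r i + b * r' i)) ^ w i := by
      rw [← Finset.prod_mul_distrib]
      refine Finset.prod_congr rfl fun i _ => ?_
      by_cases hwi : w i = 0
      · simp [hwi]
      · rw [← Real.mul_rpow (hm i) (div_nonneg (hs i) (hm i)), mul_div_cancel₀ _ (h0 i hwi)]
    rw [h1]
    refine mul_le_mul_of_nonneg_left ?_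
      (Finset.prod_nonneg fun j _ => Real.rpow_nonneg (hm j) _)
    exact Real.geom_mean_le_arith_mean_weighted _ _ _ (fun i _ => hw i) hw1
      fun i _ => div_nonneg (hs i) (hm i)
  have hsum : a * ∑ i, w i * (r i / (a * r i + b * r' i)) +
      b * ∑ i, w i * (r' i / (a * r i + b * r' i)) = 1 := by
    rw [← hw1, Finset.mul_sum, Finset.mul_sum, ← Finset.sum_add_distrib]
    refine Finset.sum_congr rfl fun i _ => ?_
    by_cases hwi : w i = 0
    · simp [hwi]
    · have := h0 i hwi
      field_simp
  calc _ ≤ a * _ + b * _ := add_le_add (mul_le_mul_of_nonneg_left (key r hr) ha)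
        (mul_le_mul_of_nonneg_left (key r' hr') hb)
    _ = (∏ i, (a * r i + b * r' i) ^ w i) * (a * ∑ i, w i * (r i / (a * r i + b * r' i)) +
      b * ∑ i, w i * (r' i / (a * r i + b * r' i))) := by ring
    _ = _ := by rw [hsum, mul_one]

section

variable [DecidableEq X] {p : X → Y → ℝ} {S : J → Finset X}

lemma convex_Kq [Fintype J] : Convex ℝ (Kq S) := by
  rintro q ⟨h1, h2, h3⟩ q' ⟨h1', h2', h3'⟩ a b ha hb hab
  refine ⟨fun j x => ?_, fun x => ?_, fun j x hx => ?_⟩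
  · simpa using add_nonneg (mul_nonneg ha (h1 j x)) (mul_nonneg hb (h1' j x))
  · calc _ = a * (∑ j, if x ∈ S j then q j x else 0) +
          b * ∑ j, if x ∈ S j then q' j x else 0 := by
          rw [Finset.mul_sum, Finset.mul_sum, ← Finset.sum_add_distrib]
          refine Finset.sum_congr rfl fun j _ => ?_
          split_ifs <;> simp
      _ = 1 := by rw [h2, h2', mul_one, mul_one, hab]
  · simp [h3 j x hx, h3' j x hx]

lemma Rmap_convex_comb [Fintype X] [Fintype Y] (a b : ℝ) (q q' : J → X → ℝ) (j : J) (y : Y) :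
    Rmap p S (a • q + b • q') j y = a * Rmap p S q j y + b * Rmap p S q' j y := by
  simp only [Rmap, Finset.mul_sum, ← Finset.sum_add_distrib]
  refine Finset.sum_congr rfl fun x _ => ?_
  split_ifs
  · simp only [Pi.add_apply, Pi.smul_apply, smul_eq_mul]
    ring
  · simp

lemma Rmap_term_nonneg [Fintype X]
    (hp : ∀ x y, 0 ≤ p x y) (hpy : ∀ y, 0 < margY p y) {q : J → X → ℝ}
    (hq : ∀ j x, 0 ≤ q j x) (j : J) (y : Y) (x : X) :
    0 ≤ if x ∈ S j then (p x y / margY p y) * q j x else 0 := by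
  split_ifs
  · exact mul_nonneg (div_nonneg (hp x y) (hpy y).le) (hq j x)
  · exact le_rfl

lemma Rmap_nonneg [Fintype X] [Fintype Y]
    (hp : ∀ x y, 0 ≤ p x y) (hpy : ∀ y, 0 < margY p y) {q : J → X → ℝ}
    (hq : ∀ j x, 0 ≤ q j x) (j : J) (y : Y) : 0 ≤ Rmap p S q j y :=
  Finset.sum_nonneg fun x _ => Rmap_term_nonneg hp hpy hq j y x

lemma eq_zero_of_Rmap_eq_zero [Fintype X] [Fintype Y]
    (hp : ∀ x y, 0 ≤ p x y) (hpy : ∀ y, 0 < margY p y)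
    {q : J → X → ℝ} (hq : ∀ j x, 0 ≤ q j x) {j : J} {x : X} {y : Y} (hx : x ∈ S j)
    (hxy : p x y ≠ 0) (h : Rmap p S q j y = 0) : q j x = 0 := by
  have h1 := (Finset.sum_eq_zero_iff_of_nonneg
    fun x _ => Rmap_term_nonneg hp hpy hq j y x).1 h x (Finset.mem_univ x)
  rw [if_pos hx] at h1
  exact (mul_eq_zero.1 h1).resolve_left (div_ne_zero hxy (hpy y).ne')

/-- `phiQexp` as a sum of relative-entropy terms. -/
lemma phiQexp_eq_sum [Fintype X] [Fintype Y] [Fintype J] (hpy : ∀ y, 0 < margY p y)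
    (q : J → X → ℝ) :
    phiQexp p S q = ∑ y, ∑ j, ∑ x, if x ∈ S j then
      p x y * (q j x * Real.log (q j x) - q j x * Real.log (Rmap p S q j y)) else 0 := by
  have h1 : ∑ x, margX p x * ∑ j, (if x ∈ S j then q j x * Real.log (q j x) else 0) =
      ∑ y, ∑ j, ∑ x, if x ∈ S j then p x y * (q j x * Real.log (q j x)) else 0 := by
    calc _ = ∑ x, ∑ y, ∑ j, if x ∈ S j then p x y * (q j x * Real.log (q j x)) else 0 := by
          refine Finset.sum_congr rfl fun x _ => ?_
          rw [margX, Finset.sum_mul]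
          refine Finset.sum_congr rfl fun y _ => ?_
          simp only [Finset.mul_sum, mul_ite, mul_zero]
      _ = ∑ y, ∑ x, ∑ j, _ := Finset.sum_comm
      _ = _ := Finset.sum_congr rfl fun y _ => Finset.sum_comm
  have h2 : ∀ y j, margY p y * (Rmap p S q j y * Real.log (Rmap p S q j y)) =
      ∑ x, if x ∈ S j then p x y * (q j x * Real.log (Rmap p S q j y)) else 0 := by
    intro y j
    have h3 : margY p y * Rmap p S q j y = ∑ x, if x ∈ S j then p x y * q j x else 0 := by
      rw [Rmap, Finset.mul_sum]
      refine Finset.sum_congr rfl fun x _ => ?_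
      have := (hpy y).ne'
      split_ifs
      · field_simp
      · simp
    rw [← mul_assoc, h3, Finset.sum_mul]
    refine Finset.sum_congr rfl fun x _ => ?_
    split_ifs
    · ring
    · simp
  rw [phiQexp, h1]
  simp only [Finset.mul_sum, h2, ← Finset.sum_sub_distrib]
  refine Finset.sum_congr rfl fun y _ => Finset.sum_congr rfl fun j _ =>
    Finset.sum_congr rfl fun x _ => ?_
  split_ifs
  · ring
  · simp

lemma convexOn_phiQexp [Fintype X] [Fintype Y] [Fintype J]
    (hp : ∀ x y, 0 ≤ p x y) (hpy : ∀ y, 0 < margY p y) :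
    ConvexOn ℝ (Kq S) (phiQexp p S) := by
  refine ⟨convex_Kq, ?_⟩
  rintro q ⟨hq, -, -⟩ q' ⟨hq', -, -⟩ a b ha hb -
  simp only [phiQexp_eq_sum hpy, smul_eq_mul, Finset.mul_sum, ← Finset.sum_add_distrib]
  refine Finset.sum_le_sum fun y _ => Finset.sum_le_sum fun j _ =>
    Finset.sum_le_sum fun x _ => ?_
  split_ifs with hx
  · rcases eq_or_ne (p x y) 0 with h0 | h0
    · simp [h0]
    rw [Rmap_convex_comb, mul_left_comm a, mul_left_comm b, ← mul_add]
    refine mul_le_mul_of_nonneg_left ?_ (hp x y)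
    exact mul_log_sub_convex_comb_le ha hb (hq j x) (Rmap_nonneg hp hpy hq j y) (hq' j x)
      (Rmap_nonneg hp hpy hq' j y) (eq_zero_of_Rmap_eq_zero hp hpy hq hx h0)
      (eq_zero_of_Rmap_eq_zero hp hpy hq' hx h0)
  · simp

lemma Afun_nonneg [Fintype Y] [Fintype J] {r : J → Y → ℝ} (hr : ∀ j y, 0 ≤ r j y)
    (x : X) : 0 ≤ Afun p S r x := by
  refine Finset.sum_nonneg fun j _ => ?_
  split_ifs
  · exact Finset.prod_nonneg fun y _ => Real.rpow_nonneg (hr j y) _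
  · exact le_rfl

lemma Afun_concave [Fintype Y] [Fintype J]
    (hp : ∀ x y, 0 ≤ p x y) (hpx : ∀ x, 0 < margX p x) {r r' : J → Y → ℝ}
    (hr : ∀ j y, 0 ≤ r j y) (hr' : ∀ j y, 0 ≤ r' j y) {a b : ℝ} (ha : 0 ≤ a) (hb : 0 ≤ b)
    (x : X) :
    a * Afun p S r x + b * Afun p S r' x ≤ Afun p S (a • r + b • r') x := by
  simp only [Afun, Finset.mul_sum, ← Finset.sum_add_distrib]
  refine Finset.sum_le_sum fun j _ => ?_
  split_ifs
  · refine prod_rpow_concave (fun y => div_nonneg (hp x y) (hpx x).le) ?_ (hr j) (hr' j) ha hb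
    rw [← Finset.sum_div]
    exact div_self (hpx x).ne'
  · simp

lemma phiR_ne_bot [Fintype X] [Fintype Y] [Fintype J] (r : J → Y → ℝ) : phiR p S r ≠ ⊥ := by
  unfold phiR
  split_ifs
  · exact top_ne_bot
  · exact EReal.coe_ne_bot _

lemma coe_mul_phiR_ne_bot [Fintype X] [Fintype Y] [Fintype J] {b : ℝ} (hb : 0 ≤ b)
    (r : J → Y → ℝ) :
    (b : EReal) * phiR p S r ≠ ⊥ := by
  rcases hb.eq_or_lt with rfl | hb
  · simp
  · intro h
    rw [EReal.mul_eq_bot] at h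
    simp [phiR_ne_bot, hb.not_gt] at h

lemma phiR_convex_comb_le [Fintype X] [Fintype Y] [Fintype J]
    (hp : ∀ x y, 0 ≤ p x y) (hpx : ∀ x, 0 < margX p x) {r r' : J → Y → ℝ}
    (hr : ∀ j y, 0 ≤ r j y) (hr' : ∀ j y, 0 ≤ r' j y) {a b : ℝ} (ha : 0 ≤ a) (hb : 0 ≤ b)
    (hab : a + b = 1) :
    phiR p S (a • r + b • r') ≤ (a : EReal) * phiR p S r + (b : EReal) * phiR p S r' := by
  rcases ha.eq_or_lt with rfl | ha
  · obtain rfl : b = 1 := by linarith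
    simp
  rcases hb.eq_or_lt with rfl | hb
  · obtain rfl : a = 1 := by linarith
    simp
  by_cases h : ∃ x, Afun p S r x = 0
  · have : phiR p S r = ⊤ := if_pos h
    rw [this, EReal.coe_mul_top_of_pos ha, EReal.top_add_of_ne_bot (coe_mul_phiR_ne_bot hb.le r')]
    exact le_top
  by_cases h' : ∃ x, Afun p S r' x = 0
  · have : phiR p S r' = ⊤ := if_pos h'
    rw [this, EReal.coe_mul_top_of_pos hb, EReal.add_top_of_ne_bot (coe_mul_phiR_ne_bot ha.le r)]
    exact le_top
  have hpos : ∀ x, 0 < Afun p S r x := fun x =>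
    (Afun_nonneg hr x).lt_of_ne fun h0 => h ⟨x, h0.symm⟩
  have hpos' : ∀ x, 0 < Afun p S r' x := fun x =>
    (Afun_nonneg hr' x).lt_of_ne fun h0 => h' ⟨x, h0.symm⟩
  have hmix : ∀ x, 0 < a * Afun p S r x + b * Afun p S r' x := fun x =>
    add_pos (mul_pos ha (hpos x)) (mul_pos hb (hpos' x))
  have hconc := Afun_concave (S := S) hp hpx hr hr' ha.le hb.le
  have h'' : ¬ ∃ x, Afun p S (a • r + b • r') x = 0 := fun ⟨x, hx⟩ =>
    ((hmix x).trans_le (hconc x)).ne' hx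
  rw [phiR, phiR, phiR, if_neg h, if_neg h', if_neg h'', ← EReal.coe_mul, ← EReal.coe_mul,
    ← EReal.coe_add, EReal.coe_le_coe_iff]
  have hsum : a * ∑ x, margX p x * Real.log (Afun p S r x) +
      b * ∑ x, margX p x * Real.log (Afun p S r' x) ≤
      ∑ x, margX p x * Real.log (Afun p S (a • r + b • r') x) := by
    rw [Finset.mul_sum, Finset.mul_sum, ← Finset.sum_add_distrib]
    refine Finset.sum_le_sum fun x _ => ?_
    rw [mul_left_comm a, mul_left_comm b, ← mul_add]
    refine mul_le_mul_of_nonneg_left ?_ (hpx x).le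
    exact (strictConcaveOn_log_Ioi.concaveOn.2 (hpos x) (hpos' x) ha.le hb.le hab).trans
      (Real.log_le_log (hmix x) (hconc x))
  linarith

end

/-- `φ_q` is convex on `K_q` (real valued, with the `0·log 0 = 0` convention)
and `φ_r` is convex on `K_r` (extended-real valued). -/
theorem phiQ_phiR_convex (X Y J : Type*) [Fintype X] [Fintype Y] [Fintype J]
    [Nonempty X] [Nonempty Y] [DecidableEq X]
    (p : X → Y → ℝ) (S : J → Finset X)
    (hp : ∀ x y, 0 ≤ p x y) (hptot : ∑ x, ∑ y, p x y = 1)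
    (hpx : ∀ x, 0 < margX p x) (hpy : ∀ y, 0 < margY p y)
    (hcov : ∀ x, ∃ j, x ∈ S j) :
    ConvexOn ℝ (Kq S) (phiQexp p S) ∧
    (∀ r ∈ Kr J Y, ∀ r' ∈ Kr J Y, ∀ a b : ℝ, 0 ≤ a → 0 ≤ b → a + b = 1 →
      phiR p S (a • r + b • r') ≤ (a : EReal) * phiR p S r + (b : EReal) * phiR p S r') := by
  exact ⟨convexOn_phiQexp hp hpy, fun r hr r' hr' a b ha hb hab =>
    phiR_convex_comb_le hp hpx hr.1 hr'.1 ha hb hab⟩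
end
end

section
/- For every r ∈ K_r with A_x(r) > 0 for all x, one has φ_r(R(Q(r))) ≤ φ_r(r), with equality if and only if R(Q(r)) = r. Consequently, every r ∈ K_r with A_x(r) > 0 for all x that minimizes φ_r over K_r satisfies R(Q(r)) = r, i.e., is a fixed point of the stepping map F_r := R ∘ Q. -/
noncomputable section

open Finset

variable {X Y J : Type*}

/-- Gibbs' inequality, pointwise form. -/
theorem sub_le_mul_log_sub_log {u v : ℝ} (hu : 0 ≤ u) (hv : 0 ≤ v) (huv : 0 < u → 0 < v) :
    u - v ≤ u * (Real.log u - Real.log v) := by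
  rcases hu.eq_or_lt with rfl | hu
  · simpa using hv
  have hv := huv hu
  have h := Real.log_le_sub_one_of_pos (div_pos hv hu)
  rw [Real.log_div hv.ne' hu.ne'] at h
  have h2 := mul_le_mul_of_nonneg_left h hu.le
  have h3 : u * (v / u - 1) = v - u := by field_simp
  linarith

/-- The equality case of the pointwise Gibbs inequality. -/
theorem eq_of_mul_log_sub_log_eq {u v : ℝ} (hu : 0 ≤ u) (huv : 0 < u → 0 < v)
    (h : u * (Real.log u - Real.log v) = u - v) : u = v := by
  rcases hu.eq_or_lt with rfl | hu
  · linarith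
  have hv := huv hu
  by_contra hne
  have hlt := Real.log_lt_sub_one_of_pos (div_pos hv hu)
    fun h1 => hne ((div_eq_one_iff_eq hu.ne').1 h1).symm
  rw [Real.log_div hv.ne' hu.ne'] at hlt
  have h2 := mul_lt_mul_of_pos_left hlt hu
  have h3 : u * (v / u - 1) = v - u := by field_simp
  linarith

/-- A weighted geometric product is positive iff no zero base carries a nonzero exponent. -/
theorem prod_rpow_pos_iff [Fintype Y] {a e : Y → ℝ} (ha : ∀ y, 0 ≤ a y) :
    0 < ∏ y, a y ^ e y ↔ ∀ y, e y ≠ 0 → 0 < a y := by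
  constructor
  · intro h y hy
    refine (ha y).lt_of_ne fun h0 => h.ne' (prod_eq_zero (mem_univ y) ?_)
    rw [← h0, Real.zero_rpow hy]
  · intro h
    refine prod_pos fun y _ => ?_
    by_cases hy : e y = 0
    · simp [hy]
    · exact Real.rpow_pos_of_pos (h y hy) _

theorem log_prod_rpow [Fintype Y] {a e : Y → ℝ} (h : ∀ y, e y ≠ 0 → 0 < a y) :
    Real.log (∏ y, a y ^ e y) = ∑ y, e y * Real.log (a y) := by
  have key (y : Y) : a y ^ e y ≠ 0 ∧ Real.log (a y ^ e y) = e y * Real.log (a y) := by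
    by_cases hy : e y = 0
    · simp [hy]
    · exact ⟨(Real.rpow_pos_of_pos (h y hy) _).ne', Real.log_rpow (h y hy) _⟩
  rw [Real.log_prod fun y _ => (key y).1]
  exact sum_congr rfl fun y _ => (key y).2

section QR

variable [Fintype Y] [Fintype J] [DecidableEq X] {p : X → Y → ℝ} {S : J → Finset X}
  {r r' : J → Y → ℝ}

theorem Qmap_nonneg (hr : ∀ j y, 0 ≤ r j y) {x : X} (hA : 0 < Afun p S r x) (j : J) :
    0 ≤ Qmap p S r j x := by
  unfold Qmap
  split_ifs
  · exact div_nonneg (prod_nonneg fun y _ => Real.rpow_nonneg (hr j y) _) hA.le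
  · exact le_rfl

theorem sum_Qmap {x : X} (hA : 0 < Afun p S r x) : ∑ j, Qmap p S r j x = 1 := by
  rw [← div_self hA.ne']
  conv_rhs => enter [1]; rw [Afun]
  rw [sum_div]
  refine sum_congr rfl fun j _ => ?_
  unfold Qmap
  split_ifs <;> simp

theorem Qmap_pos_iff (hr : ∀ j y, 0 ≤ r j y) {x : X} (hA : 0 < Afun p S r x) (j : J) :
    0 < Qmap p S r j x ↔ x ∈ S j ∧ ∀ y, p x y / margX p x ≠ 0 → 0 < r j y := by
  unfold Qmap
  split_ifs with h
  · rw [div_pos_iff_of_pos_right hA, prod_rpow_pos_iff (hr j)]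
    simp [h]
  · simp [h]

theorem log_Qmap {x : X} (hA : 0 < Afun p S r x) {j : J} (hj : x ∈ S j)
    (h : ∀ y, p x y / margX p x ≠ 0 → 0 < r j y) (hr : ∀ j y, 0 ≤ r j y) :
    Real.log (Qmap p S r j x) =
      ∑ y, p x y / margX p x * Real.log (r j y) - Real.log (Afun p S r x) := by
  rw [Qmap, if_pos hj, Real.log_div ((prod_rpow_pos_iff (hr j)).2 h).ne' hA.ne', log_prod_rpow h]

theorem Afun_pos_of_forall_pos (hr' : ∀ j y, 0 ≤ r' j y)
    {x : X} {j : J} (hj : x ∈ S j) (h : ∀ y, p x y / margX p x ≠ 0 → 0 < r' j y) :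
    0 < Afun p S r' x := by
  refine sum_pos' (fun i _ => ?_) ⟨j, mem_univ j, ?_⟩
  · split_ifs
    · exact prod_nonneg fun y _ => Real.rpow_nonneg (hr' i y) _
    · exact le_rfl
  · rw [if_pos hj]
    exact (prod_rpow_pos_iff (hr' j)).2 h

/-- Jensen's inequality for `log A_x`, under absolute continuity of `Q(r)` in `r'`. -/
theorem sum_Qmap_mul_log_le (hr : ∀ j y, 0 ≤ r j y) (hr' : ∀ j y, 0 ≤ r' j y) {x : X}
    (hA : 0 < Afun p S r x) (hA' : 0 < Afun p S r' x)
    (hac : ∀ j, 0 < Qmap p S r j x → ∀ y, p x y / margX p x ≠ 0 → 0 < r' j y) :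
    ∑ j, Qmap p S r j x * ∑ y, p x y / margX p x * (Real.log (r' j y) - Real.log (r j y)) ≤
      Real.log (Afun p S r' x) - Real.log (Afun p S r x) := by
  have key (j : J) :
      Qmap p S r j x * ∑ y, p x y / margX p x * (Real.log (r' j y) - Real.log (r j y)) ≤
      Qmap p S r j x * (Real.log (Afun p S r' x) - Real.log (Afun p S r x)) +
        (Qmap p S r' j x - Qmap p S r j x) := by
    have hpos' (h : 0 < Qmap p S r j x) : 0 < Qmap p S r' j x :=
      (Qmap_pos_iff hr' hA' j).2 ⟨((Qmap_pos_iff hr hA j).1 h).1, hac j h⟩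
    have g := sub_le_mul_log_sub_log (Qmap_nonneg hr hA j) (Qmap_nonneg hr' hA' j) hpos'
    rcases (Qmap_nonneg hr hA j).eq_or_lt with h0 | h0
    · rw [← h0] at g ⊢
      linarith
    · obtain ⟨hj, hrj⟩ := (Qmap_pos_iff hr hA j).1 h0
      rw [log_Qmap hA hj hrj hr, log_Qmap hA' hj (hac j h0) hr'] at g
      simp only [mul_sub, sum_sub_distrib] at g ⊢
      linarith
  refine (sum_le_sum fun j _ => key j).trans_eq ?_
  rw [sum_add_distrib, sum_sub_distrib, ← sum_mul, sum_Qmap hA, sum_Qmap hA']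
  ring

variable [Fintype X]

theorem Rmap_Qmap_apply (j : J) (y : Y) :
    Rmap p S (Qmap p S r) j y = ∑ x, p x y / margY p y * Qmap p S r j x := by
  refine sum_congr rfl fun x _ => ?_
  split_ifs with h
  · rfl
  · simp [Qmap, h]

theorem Rmap_Qmap_mem_Kr (hp : ∀ x y, 0 ≤ p x y) (hpy : ∀ y, 0 < margY p y)
    (hr : ∀ j y, 0 ≤ r j y) (hA : ∀ x, 0 < Afun p S r x) :
    Rmap p S (Qmap p S r) ∈ Kr J Y := by
  refine ⟨fun j y => ?_, fun y => ?_⟩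
  · rw [Rmap_Qmap_apply]
    exact sum_nonneg fun x _ =>
      mul_nonneg (div_nonneg (hp x y) (hpy y).le) (Qmap_nonneg hr (hA x) j)
  · simp only [Rmap_Qmap_apply]
    rw [sum_comm]
    simp only [← mul_sum, sum_Qmap (hA _), mul_one]
    rw [← sum_div]
    exact div_self (hpy y).ne'

theorem Rmap_Qmap_pos (hp : ∀ x y, 0 ≤ p x y) (hpy : ∀ y, 0 < margY p y)
    (hr : ∀ j y, 0 ≤ r j y) (hA : ∀ x, 0 < Afun p S r x) {x : X} {j : J}
    (hq : 0 < Qmap p S r j x) (y : Y) (hxy : p x y / margX p x ≠ 0) :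
    0 < Rmap p S (Qmap p S r) j y := by
  have hne : p x y ≠ 0 := fun h => hxy (by simp [h])
  rw [Rmap_Qmap_apply]
  exact sum_pos'
    (fun x _ => mul_nonneg (div_nonneg (hp x y) (hpy y).le) (Qmap_nonneg hr (hA x) j))
    ⟨x, mem_univ x, mul_pos (div_pos ((hp x y).lt_of_ne' hne) (hpy y)) hq⟩

theorem pos_of_Rmap_Qmap_pos (hpx : ∀ x, 0 < margX p x)
    (hr : ∀ j y, 0 ≤ r j y) (hA : ∀ x, 0 < Afun p S r x) {j : J} {y : Y}
    (h : 0 < Rmap p S (Qmap p S r) j y) : 0 < r j y := by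
  rw [Rmap_Qmap_apply] at h
  obtain ⟨x, -, hx⟩ := exists_ne_zero_of_sum_ne_zero h.ne'
  have hq := (Qmap_nonneg hr (hA x) j).lt_of_ne' (right_ne_zero_of_mul hx)
  have hxy : p x y ≠ 0 := fun h => hx (by simp [h])
  exact ((Qmap_pos_iff hr (hA x) j).1 hq).2 y (div_ne_zero hxy (hpx x).ne')

theorem Afun_Rmap_Qmap_pos (hp : ∀ x y, 0 ≤ p x y) (hpy : ∀ y, 0 < margY p y)
    (hr : ∀ j y, 0 ≤ r j y) (hA : ∀ x, 0 < Afun p S r x) (x : X) :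
    0 < Afun p S (Rmap p S (Qmap p S r)) x := by
  obtain ⟨j, -, hj⟩ := exists_ne_zero_of_sum_ne_zero ((sum_Qmap (hA x)).trans_ne one_ne_zero)
  have hq := (Qmap_nonneg hr (hA x) j).lt_of_ne' hj
  exact Afun_pos_of_forall_pos (Rmap_Qmap_mem_Kr hp hpy hr hA).1
    ((Qmap_pos_iff hr (hA x) j).1 hq).1 (Rmap_Qmap_pos hp hpy hr hA hq)

/-- The decrease of `φ_r` along one step is at least the mean relative entropy
`∑_y p^y D(R(Q(r))_{·|y} ‖ r_{·|y})`. -/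
theorem sum_relEntropy_le_sum_log_Afun (hp : ∀ x y, 0 ≤ p x y) (hpx : ∀ x, 0 < margX p x)
    (hpy : ∀ y, 0 < margY p y) (hr : ∀ j y, 0 ≤ r j y) (hA : ∀ x, 0 < Afun p S r x) :
    ∑ y, margY p y * ∑ j, Rmap p S (Qmap p S r) j y *
        (Real.log (Rmap p S (Qmap p S r) j y) - Real.log (r j y)) ≤
      ∑ x, margX p x * Real.log (Afun p S (Rmap p S (Qmap p S r)) x) -
        ∑ x, margX p x * Real.log (Afun p S r x) := by
  have hs := (Rmap_Qmap_mem_Kr hp hpy hr hA).1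
  have hjensen (x : X) := mul_le_mul_of_nonneg_left
    (sum_Qmap_mul_log_le hr hs (hA x) (Afun_Rmap_Qmap_pos hp hpy hr hA x)
      fun j hq => Rmap_Qmap_pos hp hpy hr hA hq) (hpx x).le
  rw [← sum_sub_distrib]
  simp only [← mul_sub]
  refine le_trans (le_of_eq ?_) (sum_le_sum fun x _ => hjensen x)
  set d : J → Y → ℝ := fun j y =>
    Real.log (Rmap p S (Qmap p S r) j y) - Real.log (r j y)
  have hL (y : Y) : margY p y * ∑ j, Rmap p S (Qmap p S r) j y * d j y =
      ∑ j, ∑ x, p x y * Qmap p S r j x * d j y := by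
    rw [mul_sum]
    refine sum_congr rfl fun j _ => ?_
    rw [Rmap_Qmap_apply, ← mul_assoc, mul_sum, sum_mul]
    refine sum_congr rfl fun x _ => ?_
    have := (hpy y).ne'
    field_simp
  have hR (x : X) : margX p x * ∑ j, Qmap p S r j x * ∑ y, p x y / margX p x * d j y =
      ∑ j, ∑ y, p x y * Qmap p S r j x * d j y := by
    rw [mul_sum]
    refine sum_congr rfl fun j _ => ?_
    rw [← mul_assoc, mul_sum]
    refine sum_congr rfl fun y _ => ?_
    have := (hpx x).ne'
    field_simp
  change ∑ y, margY p y * ∑ j, Rmap p S (Qmap p S r) j y * d j y =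
    ∑ x, margX p x * ∑ j, Qmap p S r j x * ∑ y, p x y / margX p x * d j y
  simp only [hL, hR]
  rw [sum_comm]
  conv_rhs => rw [sum_comm]
  exact sum_congr rfl fun j _ => sum_comm

end QR

/-- Nonnegativity of the mean relative entropy, with its equality case. -/
theorem sum_relEntropy_nonneg_and_eq [Fintype Y] [Fintype J] {m : Y → ℝ} {s r : J → Y → ℝ}
    (hm : ∀ y, 0 < m y) (hs : s ∈ Kr J Y) (hr : r ∈ Kr J Y)
    (hsr : ∀ j y, 0 < s j y → 0 < r j y) :
    0 ≤ ∑ y, m y * ∑ j, s j y * (Real.log (s j y) - Real.log (r j y)) ∧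
      (∑ y, m y * ∑ j, s j y * (Real.log (s j y) - Real.log (r j y)) = 0 → s = r) := by
  have hgap (j : J) (y : Y) :
      0 ≤ s j y * (Real.log (s j y) - Real.log (r j y)) - (s j y - r j y) :=
    sub_nonneg.2 (sub_le_mul_log_sub_log (hs.1 j y) (hr.1 j y) (hsr j y))
  have hsum (y : Y) : ∑ j, s j y * (Real.log (s j y) - Real.log (r j y)) =
      ∑ j, (s j y * (Real.log (s j y) - Real.log (r j y)) - (s j y - r j y)) := by
    rw [sum_sub_distrib, sum_sub_distrib, hs.2 y, hr.2 y]
    ring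
  simp only [hsum]
  have hinner (y : Y) := sum_nonneg fun j (_ : j ∈ univ) => hgap j y
  have hterm (y : Y) := mul_nonneg (hm y).le (hinner y)
  refine ⟨sum_nonneg fun y _ => hterm y, fun h => ?_⟩
  funext j y
  have hy := (sum_eq_zero_iff_of_nonneg fun y _ => hterm y).1 h y (mem_univ y)
  have hj := (sum_eq_zero_iff_of_nonneg fun j _ => hgap j y).1
    ((mul_eq_zero.1 hy).resolve_left (hm y).ne') j (mem_univ j)
  exact eq_of_mul_log_sub_log_eq (hs.1 j y) (hsr j y) (sub_eq_zero.1 hj)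

theorem phiR_eq_coe [Fintype X] [Fintype Y] [Fintype J] [DecidableEq X] {p : X → Y → ℝ}
    {S : J → Finset X} {r : J → Y → ℝ} (hA : ∀ x, 0 < Afun p S r x) :
    phiR p S r = ((-∑ x, margX p x * Real.log (Afun p S r x) : ℝ) : EReal) :=
  if_neg fun ⟨x, hx⟩ => (hA x).ne' hx

/-- for every `r ∈ K_r` with all `A_x(r) > 0`, `φ_r(R(Q(r))) ≤ φ_r(r)` with
equality iff `R(Q(r)) = r`; consequently every such minimizer of `φ_r` over `K_r` is a fixed
point of the stepping map `F_r = R ∘ Q`. -/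
theorem minimizer_is_fixed_point (X Y J : Type*) [Fintype X] [Fintype Y] [Fintype J]
    [Nonempty X] [Nonempty Y] [DecidableEq X]
    (p : X → Y → ℝ) (S : J → Finset X)
    (hp : ∀ x y, 0 ≤ p x y) (hptot : ∑ x, ∑ y, p x y = 1)
    (hpx : ∀ x, 0 < margX p x) (hpy : ∀ y, 0 < margY p y)
    (hcov : ∀ x, ∃ j, x ∈ S j) :
    ∀ r ∈ Kr J Y, (∀ x, 0 < Afun p S r x) →
      phiR p S (Rmap p S (Qmap p S r)) ≤ phiR p S r ∧
      (phiR p S (Rmap p S (Qmap p S r)) = phiR p S r ↔ Rmap p S (Qmap p S r) = r) ∧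
      ((∀ r' ∈ Kr J Y, phiR p S r ≤ phiR p S r') → Rmap p S (Qmap p S r) = r) := by
  intro r hr hA
  have hs := Rmap_Qmap_mem_Kr hp hpy hr.1 hA
  have hA' := Afun_Rmap_Qmap_pos hp hpy hr.1 hA
  have hstep := sum_relEntropy_le_sum_log_Afun hp hpx hpy hr.1 hA
  obtain ⟨hnonneg, hzero⟩ := sum_relEntropy_nonneg_and_eq hpy hs hr
    fun j y h => pos_of_Rmap_Qmap_pos hpx hr.1 hA h
  have hle : phiR p S (Rmap p S (Qmap p S r)) ≤ phiR p S r := by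
    rw [phiR_eq_coe hA, phiR_eq_coe hA', EReal.coe_le_coe_iff]
    linarith
  have hfix (h : phiR p S (Rmap p S (Qmap p S r)) = phiR p S r) :
      Rmap p S (Qmap p S r) = r := by
    rw [phiR_eq_coe hA, phiR_eq_coe hA', EReal.coe_eq_coe_iff] at h
    exact hzero (by linarith)
  exact ⟨hle, ⟨hfix, fun h => by rw [h]⟩, fun hmin => hfix (hle.antisymm (hmin _ hs))⟩
end
end

section
/- (Unconditioned case.) Let r ∈ Δ_𝒥 satisfy A_x(r) > 0 for every x ∈ 𝒳, D_j(r) = 1 for every j with r_j > 0, and D_j(r) ≤ 1 for every j ∈ 𝒥. Then r minimizes the function φ_r(s) := −∑_x p_x log( ∑_{j∋x} s_j ) over Δ_𝒥. -/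
noncomputable section

open Finset

/-- Unconditioned case: `A_x(r) := ∑_{j∋x} r_j`. -/
def AfunU {X J : Type*} [Fintype J] [DecidableEq X] (S : J → Finset X) (r : J → ℝ)
    (x : X) : ℝ :=
  ∑ j, if x ∈ S j then r j else 0

/-- Unconditioned case: `D_j(r) := ∑_{x∈j} p_x / A_x(r)`. -/
def DfunU {X J : Type*} [Fintype X] [Fintype J] [DecidableEq X] (p : X → ℝ)
    (S : J → Finset X) (r : J → ℝ) (j : J) : ℝ :=
  ∑ x, if x ∈ S j then p x / AfunU S r x else 0

open Classical in
/-- Unconditioned case: `φ_r(r) := −∑_x p_x log(∑_{j∋x} r_j)`, extended-real valued with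
`−log 0 = +∞`. -/
def phiRU {X J : Type*} [Fintype X] [Fintype J] [DecidableEq X] (p : X → ℝ)
    (S : J → Finset X) (r : J → ℝ) : EReal :=
  if ∃ x, AfunU S r x = 0 then ⊤
  else (((- ∑ x, p x * Real.log (AfunU S r x)) : ℝ) : EReal)

/-- Pairing the weights `s` with `D(r)` averages the ratio `A(s) / A(r)` against `p`. -/
theorem sum_mul_AfunU_div {X J : Type*} [Fintype X] [Fintype J] [DecidableEq X] (p : X → ℝ)
    (S : J → Finset X) (r s : J → ℝ) :
    ∑ x, p x * (AfunU S s x / AfunU S r x) = ∑ j, s j * DfunU p S r j := by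
  have h : ∀ x, p x * (AfunU S s x / AfunU S r x)
      = ∑ j, s j * if x ∈ S j then p x / AfunU S r x else 0 := by
    intro x
    rw [← mul_div_assoc, mul_div_right_comm]
    nth_rewrite 2 [AfunU]
    rw [Finset.mul_sum]
    refine Finset.sum_congr rfl fun j _ => ?_
    split_ifs <;> ring
  simp_rw [h, DfunU, Finset.mul_sum]
  exact Finset.sum_comm

/-- unconditioned case: if `r ∈ Δ_𝒥` satisfies `A_x(r) > 0` for every `x`,
`D_j(r) = 1` for every `j` with `r_j > 0`, and `D_j(r) ≤ 1` for every `j`, then `r` minimizes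
`φ_r(s) = −∑_x p_x log(∑_{j∋x} s_j)` over the probability simplex `Δ_𝒥`. -/
theorem unconditioned_fixed_point_is_minimizer (X J : Type*) [Fintype X] [Fintype J]
    [Nonempty X] [DecidableEq X]
    (p : X → ℝ) (hp : ∀ x, 0 < p x) (hptot : ∑ x, p x = 1)
    (S : J → Finset X) (hcov : ∀ x, ∃ j, x ∈ S j)
    (r : J → ℝ) (hrnonneg : ∀ j, 0 ≤ r j) (hrsum : ∑ j, r j = 1)
    (hA : ∀ x, 0 < AfunU S r x)
    (hfix : ∀ j, 0 < r j → DfunU p S r j = 1)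
    (hle : ∀ j, DfunU p S r j ≤ 1) :
    ∀ s : J → ℝ, (∀ j, 0 ≤ s j) → (∑ j, s j) = 1 →
      phiRU p S r ≤ phiRU p S s := by
  intro s hs hssum
  have hr : ¬ ∃ x, AfunU S r x = 0 := fun ⟨x, hx⟩ => (hA x).ne' hx
  unfold phiRU
  rw [if_neg hr]
  split_ifs with h0
  · exact le_top
  push Not at h0
  rw [EReal.coe_le_coe_iff, neg_le_neg_iff]
  have hAs : ∀ x, 0 < AfunU S s x := fun x =>
    lt_of_le_of_ne (Finset.sum_nonneg fun j _ => by split_ifs; exacts [hs j, le_rfl]) (h0 x).symm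
  have hratio : ∑ x, p x * (AfunU S s x / AfunU S r x) ≤ 1 := by
    rw [sum_mul_AfunU_div, ← hssum]
    exact Finset.sum_le_sum fun j _ => mul_le_of_le_one_right (hs j) (hle j)
  have hlog : ∀ x, p x * Real.log (AfunU S s x) ≤
      p x * Real.log (AfunU S r x) + (p x * (AfunU S s x / AfunU S r x) - p x) := by
    intro x
    have h := Real.log_le_sub_one_of_pos (div_pos (hAs x) (hA x))
    rw [Real.log_div (hAs x).ne' (hA x).ne'] at h
    have := mul_le_mul_of_nonneg_left h (hp x).le
    linarith
  have hsum := Finset.sum_le_sum fun x (_ : x ∈ Finset.univ) => hlog x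
  rw [Finset.sum_add_distrib, Finset.sum_sub_distrib, hptot] at hsum
  linarith
end
end
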